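/- arXiv:2403.16173 — 2 statements merged into one kernel-verified Lean document; each statement's English description precedes it below -/
import Mathlib

section
/- (Soundness of the combined interval-polyhedral robust counterpart.) Let n be a positive natural number, let a, â, x ∈ ℝⁿ with â_j ≥ 0 for all j, let b ∈ ℝ, and let Γ ≥ 0. Suppose there exist z ≥ 0 and p ∈ ℝⁿ with p_j ≥ 0 and z + p_j ≥ â_j·|x_j| for all j, such that ∑_j a_j x_j + z·Γ + ∑_j p_j ≤ b. Then for every perturbation vector ξ ∈ ℝⁿ with |ξ_j| ≤ 1 for all j and ∑_j |ξ_j| ≤ Γ, the perturbed constraint ∑_j (a_j + â_j ξ_j)·x_j ≤ b holds. -/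
open Finset

/-- Soundness of the combined interval-polyhedral robust counterpart: if the
Bertsimas–Sim / Li–Floudas counterpart constraints are satisfiable, then the
original constraint holds for every perturbation in the combined
interval-polyhedral uncertainty set with budget `Γ`. -/
theorem interval_polyhedral_robust_counterpart_sound (n : ℕ) (hn : 0 < n)
    (a ahat x : Fin n → ℝ) (hahat : ∀ j, 0 ≤ ahat j) (b Γ : ℝ) (hΓ : 0 ≤ Γ)
    (h : ∃ z : ℝ, ∃ p : Fin n → ℝ, 0 ≤ z ∧ (∀ j, 0 ≤ p j) ∧
      (∀ j, ahat j * |x j| ≤ z + p j) ∧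
      ∑ j, a j * x j + z * Γ + ∑ j, p j ≤ b) :
    ∀ ξ : Fin n → ℝ, (∀ j, |ξ j| ≤ 1) → (∑ j, |ξ j| ≤ Γ) →
      ∑ j, (a j + ahat j * ξ j) * x j ≤ b := by
  intro ξ hξ hs
  obtain ⟨z, p, hz, hp, hzp, hb⟩ := h
  have key : ∀ j, (a j + ahat j * ξ j) * x j ≤ a j * x j + z * |ξ j| + p j := by
    intro j
    have h1 : ξ j * x j ≤ |ξ j| * |x j| := by
      rw [← abs_mul]
      exact le_abs_self _
    have h2 := mul_le_mul_of_nonneg_left h1 (hahat j)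
    have h3 := mul_le_mul_of_nonneg_left (hzp j) (abs_nonneg (ξ j))
    have h4 := mul_le_mul_of_nonneg_right (hξ j) (hp j)
    linarith
  have hsum := Finset.sum_le_sum (fun j (_ : j ∈ Finset.univ) => key j)
  rw [Finset.sum_add_distrib, Finset.sum_add_distrib, ← Finset.mul_sum] at hsum
  have h5 := mul_le_mul_of_nonneg_left hs hz
  linarith
end

section
/- (Exactness of the combined interval-polyhedral robust counterpart.) Let n be a positive natural number, let â, x ∈ ℝⁿ with â_j ≥ 0 for all j, and let Γ ≥ 0. Then the supremum of ∑_j â_j ξ_j x_j over all ξ ∈ ℝⁿ satisfying |ξ_j| ≤ 1 for all j and ∑_j |ξ_j| ≤ Γ equals the infimum of z·Γ + ∑_j p_j over all z ≥ 0 and p ∈ ℝⁿ with p_j ≥ 0 and z + p_j ≥ â_j·|x_j| for all j. -/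
open Finset

lemma ipd_threshold (n : ℕ) (c : Fin n → ℝ) (hc : ∀ j, 0 ≤ c j) (Γ : ℝ) (hΓ : 0 ≤ Γ)
    (hn : Γ < n) : ∃ z : ℝ, 0 ≤ z ∧ ((univ.filter fun j => z < c j).card : ℝ) ≤ Γ ∧
      Γ ≤ ((univ.filter fun j => z ≤ c j).card : ℝ) := by
  classical
  set V : Finset ℝ := insert 0 (univ.image c) with hV
  have hcV : ∀ j, c j ∈ V := fun j => by simp [hV]
  have hV0 : ∀ v ∈ V, 0 ≤ v := by
    intro v hv
    simp only [hV, Finset.mem_insert, Finset.mem_image, Finset.mem_univ, true_and] at hv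
    rcases hv with rfl | ⟨j, rfl⟩
    · exact le_rfl
    · exact hc j
  have h0V : (0 : ℝ) ∈ V := by simp [hV]
  set F := V.filter (fun v => ((univ.filter fun j => v < c j).card : ℝ) ≤ Γ) with hF
  have hFne : F.Nonempty := by
    obtain ⟨m, hm, hmax⟩ := V.exists_max_image id ⟨0, h0V⟩
    refine ⟨m, Finset.mem_filter.2 ⟨hm, ?_⟩⟩
    have : (univ.filter fun j => m < c j) = ∅ := by
      apply Finset.filter_eq_empty_iff.2
      intro j _
      exact not_lt.2 (hmax _ (hcV j))
    rw [this]; simpa using hΓ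
  obtain ⟨z, hz, hmin⟩ := F.exists_min_image id hFne
  obtain ⟨hzV, hzΓ⟩ := Finset.mem_filter.1 hz
  refine ⟨z, hV0 z hzV, hzΓ, ?_⟩
  rcases (hV0 z hzV).eq_or_lt with h | h
  · have : (univ.filter fun j => z ≤ c j) = univ := by
      apply Finset.filter_true_of_mem
      intro j _
      rw [← h]; exact hc j
    rw [this]; simpa using hn.le
  · obtain ⟨v, hv, hvmax⟩ := (V.filter (· < z)).exists_max_image id
      ⟨0, Finset.mem_filter.2 ⟨h0V, h⟩⟩
    obtain ⟨hvV, hvz⟩ := Finset.mem_filter.1 hv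
    have h1 : Γ < ((univ.filter fun j => v < c j).card : ℝ) := by
      by_contra hcon
      have := hmin v (Finset.mem_filter.2 ⟨hvV, not_lt.1 hcon⟩)
      exact absurd hvz (not_lt.2 this)
    refine h1.le.trans ?_
    have : (univ.filter fun j => v < c j) ⊆ (univ.filter fun j => z ≤ c j) := by
      intro j hj
      simp only [Finset.mem_filter, Finset.mem_univ, true_and] at hj ⊢
      by_contra hcon
      have := hvmax (c j) (Finset.mem_filter.2 ⟨hcV j, not_le.1 hcon⟩)
      exact absurd hj (not_lt.2 this)
    exact_mod_cast Finset.card_le_card this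

lemma ipd_weights (n : ℕ) (c : Fin n → ℝ) (hc : ∀ j, 0 ≤ c j) (Γ : ℝ) (hΓ : 0 ≤ Γ) :
    ∃ (z : ℝ) (w : Fin n → ℝ), 0 ≤ z ∧ (∀ j, 0 ≤ w j) ∧ (∀ j, w j ≤ 1) ∧ ∑ j, w j ≤ Γ ∧
      z * ∑ j, w j = z * Γ ∧ ∀ j, w j * (c j - z) = max (c j - z) 0 := by
  classical
  rcases le_or_gt (n : ℝ) Γ with hn | hn
  · refine ⟨0, fun _ => 1, le_rfl, fun _ => zero_le_one, fun _ => le_rfl, by simpa using hn,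
      by simp, fun j => ?_⟩
    simp [hc j]
  obtain ⟨z, hz, hK, hKM⟩ := ipd_threshold n c hc Γ hΓ hn
  set K : ℝ := ((univ.filter fun j => z < c j).card : ℝ) with hKdef
  set M : ℝ := ((univ.filter fun j => z = c j).card : ℝ) with hMdef
  have hM0 : 0 ≤ M := Nat.cast_nonneg _
  have hsum : ((univ.filter fun j => z ≤ c j).card : ℝ) = K + M := by
    rw [hKdef, hMdef, ← Nat.cast_add, ← Finset.card_union_of_disjoint]
    · congr 2
      ext j
      simp [le_iff_lt_or_eq]
    · rw [Finset.disjoint_filter]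
      intro j _ h h'
      exact h.ne h'
  rw [hsum] at hKM
  obtain ⟨θ, hθ0, hθ1, hθ⟩ : ∃ θ : ℝ, 0 ≤ θ ∧ θ ≤ 1 ∧ M * θ = Γ - K := by
    rcases hM0.eq_or_lt with h | h
    · exact ⟨0, le_rfl, zero_le_one, by linarith⟩
    · refine ⟨(Γ - K) / M, div_nonneg (by linarith) hM0, (div_le_one h).2 (by linarith), ?_⟩
      field_simp
  have hw : ∑ j, ((if z < c j then (1 : ℝ) else 0) + (if z = c j then θ else 0)) = Γ := by
    rw [Finset.sum_add_distrib, ← Finset.sum_filter, ← Finset.sum_filter]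
    simp only [Finset.sum_const, nsmul_eq_mul, mul_one]
    rw [← hKdef, ← hMdef]
    linarith
  refine ⟨z, fun j => (if z < c j then (1 : ℝ) else 0) + (if z = c j then θ else 0), hz,
    fun j => ?_, fun j => ?_, hw.le, by rw [hw], fun j => ?_⟩
  · positivity
  · rcases lt_trichotomy z (c j) with h | h | h
    · simp [h, h.ne]
    · simp [← h, hθ1]
    · simp [h.not_gt, h.ne']
  · rcases lt_trichotomy z (c j) with h | h | h
    · simp [h, h.ne, h.le]
    · simp [← h]
    · simp [h.not_gt, h.ne', h.le]

/-- Exactness of the combined interval-polyhedral robust counterpart: the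
supremum of `∑ j, ahat j * ξ j * x j` over the combined interval-polyhedral
uncertainty set equals the infimum of `z * Γ + ∑ j, p j` over the dual
feasible auxiliary variables. -/
theorem interval_polyhedral_protection_duality (n : ℕ) (hn : 0 < n)
    (ahat x : Fin n → ℝ) (hahat : ∀ j, 0 ≤ ahat j) (Γ : ℝ) (hΓ : 0 ≤ Γ) :
    sSup {s : ℝ | ∃ ξ : Fin n → ℝ, (∀ j, |ξ j| ≤ 1) ∧ (∑ j, |ξ j| ≤ Γ) ∧
        s = ∑ j, ahat j * ξ j * x j} =
      sInf {v : ℝ | ∃ z : ℝ, ∃ p : Fin n → ℝ, 0 ≤ z ∧ (∀ j, 0 ≤ p j) ∧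
        (∀ j, ahat j * |x j| ≤ z + p j) ∧ v = z * Γ + ∑ j, p j} := by
  have weak : ∀ (ξ : Fin n → ℝ) (z : ℝ) (p : Fin n → ℝ), (∀ j, |ξ j| ≤ 1) → (∑ j, |ξ j| ≤ Γ) →
      0 ≤ z → (∀ j, 0 ≤ p j) → (∀ j, ahat j * |x j| ≤ z + p j) →
      ∑ j, ahat j * ξ j * x j ≤ z * Γ + ∑ j, p j := by
    intro ξ z p h1 h2 hz hp hzp
    calc ∑ j, ahat j * ξ j * x j ≤ ∑ j, (z * |ξ j| + p j) := by
          apply Finset.sum_le_sum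
          intro j _
          have e1 : ahat j * ξ j * x j ≤ (ahat j * |x j|) * |ξ j| := by
            have := mul_le_mul_of_nonneg_left (le_abs_self (ξ j * x j)) (hahat j)
            rw [abs_mul] at this
            linarith
          have e2 := mul_le_mul_of_nonneg_right (hzp j) (abs_nonneg (ξ j))
          have e3 := mul_le_mul_of_nonneg_left (h1 j) (hp j)
          linarith
      _ = z * ∑ j, |ξ j| + ∑ j, p j := by rw [Finset.sum_add_distrib, Finset.mul_sum]
      _ ≤ _ := by
          have := mul_le_mul_of_nonneg_left h2 hz
          linarith
  obtain ⟨z, w, hz, hw0, hw1, hwΓ, hzw, hcs⟩ := ipd_weights n (fun j => ahat j * |x j|)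
    (fun j => mul_nonneg (hahat j) (abs_nonneg _)) Γ hΓ
  set ξ : Fin n → ℝ := fun j => w j * (if 0 ≤ x j then 1 else -1) with hξ
  set p : Fin n → ℝ := fun j => max (ahat j * |x j| - z) 0 with hp
  have habs : ∀ j, |ξ j| = w j := by
    intro j
    simp only [hξ]
    split_ifs <;> simp [abs_of_nonneg (hw0 j)]
  have hξ1 : ∀ j, |ξ j| ≤ 1 := fun j => by rw [habs]; exact hw1 j
  have hξ2 : ∑ j, |ξ j| ≤ Γ := by simpa only [habs] using hwΓ
  have hp0 : ∀ j, 0 ≤ p j := fun j => le_max_right _ _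
  have hp1 : ∀ j, ahat j * |x j| ≤ z + p j := fun j => by
    have := le_max_left (ahat j * |x j| - z) 0
    simp only [hp]; linarith
  have heq : ∑ j, ahat j * ξ j * x j = z * Γ + ∑ j, p j := by
    rw [← hzw, Finset.mul_sum, ← Finset.sum_add_distrib]
    apply Finset.sum_congr rfl
    intro j _
    have h := hcs j
    have h' : ahat j * ξ j * x j = w j * (ahat j * |x j|) := by
      simp only [hξ]
      split_ifs with h0
      · rw [abs_of_nonneg h0]; ring
      · rw [abs_of_neg (not_le.1 h0)]; ring
    simp only [hp]
    rw [h', ← h]; ring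
  have hA : IsGreatest {s : ℝ | ∃ ξ : Fin n → ℝ, (∀ j, |ξ j| ≤ 1) ∧ (∑ j, |ξ j| ≤ Γ) ∧
        s = ∑ j, ahat j * ξ j * x j} (z * Γ + ∑ j, p j) := by
    refine ⟨⟨ξ, hξ1, hξ2, heq.symm⟩, ?_⟩
    rintro s ⟨η, h1, h2, rfl⟩
    exact weak η z p h1 h2 hz hp0 hp1
  have hB : IsLeast {v : ℝ | ∃ z : ℝ, ∃ p : Fin n → ℝ, 0 ≤ z ∧ (∀ j, 0 ≤ p j) ∧
        (∀ j, ahat j * |x j| ≤ z + p j) ∧ v = z * Γ + ∑ j, p j} (z * Γ + ∑ j, p j) := by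
    refine ⟨⟨z, p, hz, hp0, hp1, rfl⟩, ?_⟩
    rintro v ⟨z', p', h1, h2, h3, rfl⟩
    rw [← heq]
    exact weak ξ z' p' hξ1 hξ2 h1 h2 h3
  rw [hA.csSup_eq, hB.csInf_eq]
end
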